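/- Let A and B be skew shapes. If s_A − s_B is F-positive, then rows_k(A) ⊴ rows_k(B) for all k ≥ 1, cols_ℓ(A) ⊴ cols_ℓ(B) for all ℓ ≥ 1, and rects_{k,ℓ}(A) ≤ rects_{k,ℓ}(B) for all k, ℓ ≥ 1. -/

import Mathlib

namespace SkewPaper

open Finset

/-- A skew shape `λ/μ`, given by Young diagrams `μ ≤ λ`. -/
structure SkewShape where
  lam : YoungDiagram
  mu : YoungDiagram
  sub : mu ≤ lam

namespace SkewShape

/-- The cells (boxes) of the skew shape `λ/μ`. -/
def cells (A : SkewShape) : Finset (ℕ × ℕ) :=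
  A.lam.cells \ A.mu.cells

/-- The number of boxes of `A`. -/
def size (A : SkewShape) : ℕ := A.cells.card

end SkewShape

/-- The set of columns occupied by row `i` of the cell set `s`. -/
def rowCols (s : Finset (ℕ × ℕ)) (i : ℕ) : Finset ℕ :=
  (s.filter (fun c => c.1 = i)).image Prod.snd

/-- The set of rows occupied by column `j` of the cell set `s`. -/
def colRows (s : Finset (ℕ × ℕ)) (j : ℕ) : Finset ℕ :=
  (s.filter (fun c => c.2 = j)).image Prod.fst

/-- `overlapRow s k i` : the number of columns occupied in common by
rows `i, i+1, …, i+k-1` of `s`. -/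
def overlapRow (s : Finset (ℕ × ℕ)) (k i : ℕ) : ℕ :=
  ((rowCols s i).filter (fun j => ∀ t, t < k → j ∈ rowCols s (i + t))).card

/-- `overlapCol s l j` : the number of rows occupied in common by
columns `j, j+1, …, j+l-1` of `s`. -/
def overlapCol (s : Finset (ℕ × ℕ)) (l j : ℕ) : ℕ :=
  ((colRows s j).filter (fun i => ∀ t, t < l → i ∈ colRows s (j + t))).card

/-- `rows_k`: the partition (as the multiset of its nonzero parts) of overlaps of
`k` consecutive rows. -/
def rowsk (s : Finset (ℕ × ℕ)) (k : ℕ) : Multiset ℕ :=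
  ((s.image Prod.fst).val.map (overlapRow s k)).filter (fun m => 0 < m)

/-- `cols_l`: the partition (as the multiset of its nonzero parts) of overlaps of
`l` consecutive columns. -/
def colsk (s : Finset (ℕ × ℕ)) (l : ℕ) : Multiset ℕ :=
  ((s.image Prod.snd).val.map (overlapCol s l)).filter (fun m => 0 < m)

/-- `rects s k l`: the number of `k × l` rectangles of boxes contained inside `s`. -/
def rects (s : Finset (ℕ × ℕ)) (k l : ℕ) : ℕ :=
  (s.filter (fun c => ∀ a, a < k → ∀ b, b < l → (c.1 + a, c.2 + b) ∈ s)).card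

/-- The weakly decreasing sorted list of a multiset: the partition with those parts. -/
def sortDesc (s : Multiset ℕ) : List ℕ := (s.sort (· ≤ ·)).reverse

/-- Dominance order on partitions presented as multisets of parts:
every partial sum of the decreasing sort of `s` is at most the corresponding
partial sum for `t` (missing parts treated as `0`). -/
def Dom (s t : Multiset ℕ) : Prop :=
  ∀ j : ℕ, ((sortDesc s).take j).sum ≤ ((sortDesc t).take j).sum

/-- The conjugate (transpose) of a partition presented as a multiset of parts. -/
def conjM (s : Multiset ℕ) : Multiset ℕ :=
  (Multiset.range s.sup).map (fun j => Multiset.card (s.filter (fun x => j < x)))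

/-- A standard Young tableau of shape `A`: a bijective filling of the cells of `A`
by `1, …, |A|` which increases from left to right along rows and from top to
bottom down columns.  (Entries off the shape are normalized to `0`.) -/
structure SYT (A : SkewShape) where
  entry : ℕ × ℕ → ℕ
  zero_off : ∀ c, c ∉ A.cells → entry c = 0
  mem_range : ∀ c ∈ A.cells, entry c ∈ Finset.Icc 1 A.size
  injOn : Set.InjOn entry ↑A.cells
  row_lt : ∀ i j j', (i, j) ∈ A.cells → (i, j') ∈ A.cells → j < j' →
    entry (i, j) < entry (i, j')
  col_lt : ∀ i i' j, (i, j) ∈ A.cells → (i', j) ∈ A.cells → i < i' →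
    entry (i, j) < entry (i', j)

/-- The descent set of a standard Young tableau: those `k ∈ {1, …, n-1}` such that
`k+1` appears in a strictly lower row than `k`. -/
def SYT.descentSet {A : SkewShape} (T : SYT A) : Finset ℕ :=
  (Finset.Ico 1 A.size).filter (fun k =>
    ∃ c ∈ A.cells, ∃ c' ∈ A.cells, T.entry c = k ∧ T.entry c' = k + 1 ∧ c.1 < c'.1)

/-- The composition of `n` corresponding to a subset `D ⊆ {1, …, n-1}`:
its partial sums are the elements of `D`. -/
def compOfSet (n : ℕ) (D : Finset ℕ) : List ℕ :=
  if n = 0 then []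
  else
    let l := D.sort (· ≤ ·) ++ [n]
    List.zipWith (fun x y => x - y) l (0 :: l)

/-- The descent composition of a standard Young tableau. -/
def SYT.descentComp {A : SkewShape} (T : SYT A) : List ℕ :=
  compOfSet A.size T.descentSet

/-- The F-support of `A`: the set of descent compositions of SYT of shape `A`. -/
def Fsupp (A : SkewShape) : Set (List ℕ) :=
  {α | ∃ T : SYT A, T.descentComp = α}

/-- The number of standard Young tableaux of shape `A` with descent composition `α`. -/
noncomputable def countSYT (A : SkewShape) (α : List ℕ) : ℕ :=
  Nat.card {T : SYT A // T.descentComp = α}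

/-- `S(γ)`: the set of proper partial sums of the composition `γ`. -/
def Sset (γ : List ℕ) : Finset ℕ :=
  ((List.range (γ.length - 1)).map (fun j => (γ.take (j + 1)).sum)).toFinset

/-- `cols(α)` for a composition `α` of `n`, as a multiset: the parts of the
composition corresponding to the complement of `S(α)` in `{1, …, n-1}`. -/
def colsComp (α : List ℕ) : Multiset ℕ :=
  ↑(compOfSet α.sum ((Finset.Icc 1 (α.sum - 1)) \ Sset α))

/-- Delete the leftmost box of every nonempty row. -/
def trimCells (s : Finset (ℕ × ℕ)) : Finset (ℕ × ℕ) :=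
  s.filter (fun c => 1 ≤ c.2 ∧ (c.1, c.2 - 1) ∈ s)

/-- `s` is a ribbon whose (nonempty) rows are exactly rows `r0, …, r1`, with every
pair of adjacent rows overlapping in exactly one column. -/
def IsRibbonOn (s : Finset (ℕ × ℕ)) (r0 r1 : ℕ) : Prop :=
  r0 ≤ r1 ∧ (∀ i, (rowCols s i).Nonempty ↔ r0 ≤ i ∧ i ≤ r1) ∧
    (∀ i, r0 ≤ i → i < r1 → (rowCols s i ∩ rowCols s (i + 1)).card = 1)

/-- `A` is a ribbon. -/
def SkewShape.IsRibbon (A : SkewShape) : Prop :=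
  ∃ r0 r1, IsRibbonOn A.cells r0 r1

/-- An elongated ribbon: a ribbon all of whose rows have length at least two. -/
def ElongatedRibbon (A : SkewShape) : Prop :=
  A.IsRibbon ∧ ∀ i, (rowCols A.cells i).Nonempty → 2 ≤ (rowCols A.cells i).card

/-- A horizontal strip: at most one box in each column. -/
def IsHorizontalStrip (A : SkewShape) : Prop :=
  ∀ j, (colRows A.cells j).card ≤ 1

/-- `A` is F-multiplicity-free: distinct SYT of shape `A` have distinct descent sets. -/
def FMultFree (A : SkewShape) : Prop :=
  ∀ T T' : SYT A, T.descentSet = T'.descentSet → T = T'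

/-- The cells of a shape, viewed inside `ℤ × ℤ`. -/
def toZ (s : Finset (ℕ × ℕ)) : Finset (ℤ × ℤ) :=
  s.image (fun c => ((c.1 : ℤ), (c.2 : ℤ)))

/-- The cells of the hook `(m, 1^l)`. -/
def hookCells (m l : ℕ) : Finset (ℕ × ℕ) :=
  ((Finset.range m).image (fun j => ((0 : ℕ), j))) ∪
    ((Finset.Icc 1 l).image (fun i => (i, (0 : ℕ))))

lemma SkewShape.mem_cells {A : SkewShape} {i j : ℕ} :
    (i, j) ∈ A.cells ↔ A.mu.rowLen i ≤ j ∧ j < A.lam.rowLen i := by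
  simp only [SkewShape.cells, mem_sdiff, YoungDiagram.mem_cells, YoungDiagram.mem_iff_lt_rowLen]
  omega

/-- The box set of a skew shape is order-convex. -/
lemma SkewShape.mem_cells_of_between {A : SkewShape} {i i' j j' r c : ℕ}
    (h : (i, j) ∈ A.cells) (h' : (i', j') ∈ A.cells)
    (hir : i ≤ r) (hri : r ≤ i') (hjc : j ≤ c) (hcj : c ≤ j') : (r, c) ∈ A.cells := by
  rw [SkewShape.mem_cells] at *
  have h1 := A.mu.rowLen_anti i r hir
  have h2 := A.lam.rowLen_anti r i' hri
  omega

namespace SYT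

variable {A : SkewShape} (T : SYT A)

instance : Finite (SYT A) := by
  refine Finite.of_injective
    (fun (T : SYT A) (c : A.cells) => (⟨T.entry c, T.mem_range c c.2⟩ : Finset.Icc 1 A.size)) ?_
  intro T T' h
  have key : T.entry = T'.entry := by
    funext c
    by_cases hc : c ∈ A.cells
    · exact congrArg Subtype.val (congrFun h ⟨c, hc⟩)
    · rw [T.zero_off c hc, T'.zero_off c hc]
  cases T
  cases T'
  simpa using key

lemma exists_entry_eq {v : ℕ} (h1 : 1 ≤ v) (h2 : v ≤ A.size) :
    ∃ c ∈ A.cells, T.entry c = v := by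
  have hs : Set.SurjOn T.entry ↑A.cells ↑(Finset.Icc 1 A.size) :=
    Finset.surjOn_of_injOn_of_card_le _ (fun c hc => T.mem_range c hc) T.injOn
      (by simp [SkewShape.size])
  exact hs (by simp [h1, h2])

lemma entry_le_of_le {i i' j j' : ℕ} (h : (i, j) ∈ A.cells) (h' : (i', j') ∈ A.cells)
    (hi : i ≤ i') (hj : j ≤ j') : T.entry (i, j) ≤ T.entry (i', j') := by
  have hm := SkewShape.mem_cells_of_between h h' le_rfl hi hj le_rfl
  have h1 : T.entry (i, j) ≤ T.entry (i, j') := by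
    rcases hj.eq_or_lt with rfl | hj
    · exact le_rfl
    · exact (T.row_lt _ _ _ h hm hj).le
  have h2 : T.entry (i, j') ≤ T.entry (i', j') := by
    rcases hi.eq_or_lt with rfl | hi
    · exact le_rfl
    · exact (T.col_lt _ _ _ hm h' hi).le
  exact h1.trans h2

lemma mem_descentSet_iff {x y : ℕ × ℕ} (hx : x ∈ A.cells) (hy : y ∈ A.cells)
    (h : T.entry y = T.entry x + 1) : T.entry x ∈ T.descentSet ↔ x.1 < y.1 := by
  have hx' := Finset.mem_Icc.1 (T.mem_range x hx)
  have hy' := Finset.mem_Icc.1 (T.mem_range y hy)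
  simp only [descentSet, Finset.mem_filter, Finset.mem_Ico]
  constructor
  · rintro ⟨-, c, hc, c', hc', h1, h2, h3⟩
    rwa [T.injOn hc hx h1, T.injOn hc' hy (h2.trans h.symm)] at h3
  · intro hlt
    exact ⟨by omega, x, hx, y, hy, rfl, h, hlt⟩

lemma snd_lt_of_notMem_descentSet {x y : ℕ × ℕ} (hx : x ∈ A.cells) (hy : y ∈ A.cells)
    (h : T.entry y = T.entry x + 1) (hd : T.entry x ∉ T.descentSet) : x.2 < y.2 := by
  rw [T.mem_descentSet_iff hx hy h] at hd
  by_contra hlt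
  have := T.entry_le_of_le (i := y.1) (j := y.2) (i' := x.1) (j' := x.2) hy hx
    (by omega) (by omega)
  simp only [Prod.mk.eta] at this
  omega

/-- If a statistic strictly increases between consecutive entries in the interval `(s, e]`,
then it strictly increases on the whole interval. -/
lemma lt_of_step (f : ℕ × ℕ → ℕ) {s e : ℕ}
    (hf : ∀ x ∈ A.cells, ∀ y ∈ A.cells, s < T.entry x → T.entry x < e →
      T.entry y = T.entry x + 1 → f x < f y)
    {x y : ℕ × ℕ} (hx : x ∈ A.cells) (hy : y ∈ A.cells) (hsx : s < T.entry x)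
    (hxy : T.entry x < T.entry y) (hye : T.entry y ≤ e) : f x < f y := by
  obtain ⟨d, hd⟩ := Nat.exists_eq_add_of_lt hxy
  induction d generalizing y with
  | zero => exact hf x hx y hy hsx (by omega) (by omega)
  | succ d ih =>
    have hy' := Finset.mem_Icc.1 (T.mem_range y hy)
    obtain ⟨z, hz, hze⟩ := T.exists_entry_eq (v := T.entry x + d + 1) (by omega) (by omega)
    exact (ih hz (by omega) (by omega) hze).trans
      (hf z hz y hy (by omega) (by omega) (by omega))

/-- The filling of a skew shape obtained by listing its boxes in the order of an injective,
row- and column-increasing key. -/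
def ofKey {ι : Type*} [LinearOrder ι] (A : SkewShape) (κ : ℕ × ℕ → ι)
    (hinj : Set.InjOn κ ↑A.cells)
    (hrow : ∀ i j j', (i, j) ∈ A.cells → (i, j') ∈ A.cells → j < j' → κ (i, j) < κ (i, j'))
    (hcol : ∀ i i' j, (i, j) ∈ A.cells → (i', j) ∈ A.cells → i < i' → κ (i, j) < κ (i', j)) :
    SYT A :=
  have hlt : ∀ c ∈ A.cells, ∀ c' ∈ A.cells, κ c < κ c' →
      (A.cells.filter (fun x => κ x ≤ κ c)).card < (A.cells.filter (fun x => κ x ≤ κ c')).card := by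
    intro c _ c' hc' h
    refine Finset.card_lt_card (Finset.ssubset_iff_of_subset ?_ |>.2 ⟨c', ?_, ?_⟩)
    · exact Finset.monotone_filter_right _ (fun x _ hx => le_trans hx h.le)
    · simp [hc']
    · simp [h]
  { entry := fun c => if c ∈ A.cells then (A.cells.filter (fun x => κ x ≤ κ c)).card else 0
    zero_off := fun c hc => if_neg hc
    mem_range := by
      intro c hc
      rw [if_pos hc, Finset.mem_Icc]
      exact ⟨Finset.card_pos.2 ⟨c, by simp [hc]⟩, Finset.card_filter_le _ _⟩
    injOn := by
      intro c hc c' hc' h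
      have hc := Finset.mem_coe.1 hc
      have hc' := Finset.mem_coe.1 hc'
      simp only [if_pos hc, if_pos hc'] at h
      rcases lt_trichotomy (κ c) (κ c') with hk | hk | hk
      · exact absurd h (hlt c hc c' hc' hk).ne
      · exact hinj hc hc' hk
      · exact absurd h (hlt c' hc' c hc hk).ne'
    row_lt := by
      intro i j j' h h' hj
      simp only [if_pos h, if_pos h']
      exact hlt _ h _ h' (hrow _ _ _ h h' hj)
    col_lt := by
      intro i i' j h h' hi
      simp only [if_pos h, if_pos h']
      exact hlt _ h _ h' (hcol _ _ _ h h' hi) }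

lemma entry_ofKey {ι : Type*} [LinearOrder ι] {A : SkewShape} {κ : ℕ × ℕ → ι} {hinj hrow hcol}
    {c : ℕ × ℕ} (hc : c ∈ A.cells) :
    (ofKey A κ hinj hrow hcol).entry c = (A.cells.filter (fun x => κ x ≤ κ c)).card :=
  if_pos hc

end SYT

section Peeling

variable (A : SkewShape) (a : ℕ)

/-- The index of the strip containing a box when `A` is peeled by first removing `a` times the
leftmost box of every row, and then repeatedly the top box of every column. -/
def strip (c : ℕ × ℕ) : ℕ :=
  if c.2 < A.mu.rowLen c.1 + a then c.2 - A.mu.rowLen c.1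
  else a + (c.1 - A.mu.colLen (c.2 - a))

/-- The position of a box inside its strip: vertical strips are read downwards, horizontal
strips rightwards. -/
def stripPos (c : ℕ × ℕ) : ℕ :=
  if c.2 < A.mu.rowLen c.1 + a then c.1 else c.2

/-- The reading order of the peeling. -/
def stripKey (c : ℕ × ℕ) : ℕ ×ₗ ℕ := toLex (strip A a c, stripPos A a c)

variable {A a}

lemma colLen_le_of_rowLen_le {μ : YoungDiagram} {i j : ℕ} (h : μ.rowLen i ≤ j) :
    μ.colLen j ≤ i := by
  by_contra hlt
  have := YoungDiagram.mem_iff_lt_rowLen.1 (YoungDiagram.mem_iff_lt_colLen.2 (not_le.1 hlt))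
  omega

lemma stripKey_lt {c c' : ℕ × ℕ} : stripKey A a c < stripKey A a c' ↔
    strip A a c < strip A a c' ∨
      strip A a c = strip A a c' ∧ stripPos A a c < stripPos A a c' :=
  Prod.Lex.toLex_lt_toLex

lemma stripKey_injOn : Set.InjOn (stripKey A a) ↑A.cells := by
  rintro ⟨i, j⟩ hc ⟨i', j'⟩ hc' h
  have hc := SkewShape.mem_cells.1 (Finset.mem_coe.1 hc)
  have hc' := SkewShape.mem_cells.1 (Finset.mem_coe.1 hc')
  have h1 : strip A a (i, j) = strip A a (i', j') := congrArg (fun x => (ofLex x).1) h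
  have h2 : stripPos A a (i, j) = stripPos A a (i', j') := congrArg (fun x => (ofLex x).2) h
  simp only [strip, stripPos] at h1 h2
  split_ifs at h1 h2 with h3 h4 h4
  · subst h2
    simp only [Prod.mk.injEq, true_and]
    omega
  · omega
  · omega
  · subst h2
    have h5 := colLen_le_of_rowLen_le (μ := A.mu) (i := i) (j := j - a) (by omega)
    have h6 := colLen_le_of_rowLen_le (μ := A.mu) (i := i') (j := j - a) (by omega)
    simp only [Prod.mk.injEq, and_true]
    omega

lemma stripKey_row_lt (i j j' : ℕ) (h : (i, j) ∈ A.cells) (h' : (i, j') ∈ A.cells)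
    (hj : j < j') : stripKey A a (i, j) < stripKey A a (i, j') := by
  rw [SkewShape.mem_cells] at h h'
  rw [stripKey_lt]
  have := A.mu.colLen_anti (j - a) (j' - a) (by omega)
  simp only [strip, stripPos]
  split_ifs <;> omega

lemma stripKey_col_lt (i i' j : ℕ) (h : (i, j) ∈ A.cells) (h' : (i', j) ∈ A.cells)
    (hi : i < i') : stripKey A a (i, j) < stripKey A a (i', j) := by
  rw [SkewShape.mem_cells] at h h'
  rw [stripKey_lt]
  have h1 := A.mu.rowLen_anti i i' hi.le
  have h2 : A.mu.rowLen i + a ≤ j → A.mu.colLen (j - a) ≤ i := fun h =>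
    colLen_le_of_rowLen_le (by omega)
  simp only [strip, stripPos]
  split_ifs <;> omega

lemma fst_lt_of_strip_eq {c c' : ℕ × ℕ} (hlt : strip A a c < a)
    (heq : strip A a c = strip A a c') (h : stripPos A a c < stripPos A a c') : c.1 < c'.1 := by
  simp only [strip, stripPos] at *
  split_ifs at * <;> omega

lemma fst_le_of_strip_eq {c c' : ℕ × ℕ} (hle : a ≤ strip A a c)
    (hc : c ∈ A.cells) (hc' : c' ∈ A.cells)
    (heq : strip A a c = strip A a c') (h : stripPos A a c < stripPos A a c') : c'.1 ≤ c.1 := by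
  obtain ⟨i, j⟩ := c
  obtain ⟨i', j'⟩ := c'
  rw [SkewShape.mem_cells] at hc hc'
  simp only [strip, stripPos] at *
  split_ifs at * with h1 h2 h2
  any_goals omega
  have h3 := colLen_le_of_rowLen_le (μ := A.mu) (i := i) (j := j - a) (by omega)
  have h4 := colLen_le_of_rowLen_le (μ := A.mu) (i := i') (j := j' - a) (by omega)
  have h5 := A.mu.colLen_anti (j - a) (j' - a) (by omega)
  omega

variable (A a) in
/-- The tableau listing the boxes in the reading order of the peeling. -/
def peelTableau : SYT A :=
  SYT.ofKey A (stripKey A a) stripKey_injOn stripKey_row_lt stripKey_col_lt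

variable (A a) in
/-- The number of boxes in the first `m` strips. -/
def stripEnd (m : ℕ) : ℕ := (A.cells.filter (fun c => strip A a c < m)).card

lemma peelTableau_entry_le_iff {c : ℕ × ℕ} (hc : c ∈ A.cells) (m : ℕ) :
    (peelTableau A a).entry c ≤ stripEnd A a m ↔ strip A a c < m := by
  rw [peelTableau, SYT.entry_ofKey hc, stripEnd]
  have hmono : ∀ x, stripKey A a x ≤ stripKey A a c → strip A a x ≤ strip A a c := by
    intro x hx
    by_contra hlt
    exact absurd (stripKey_lt.2 (Or.inl (not_le.1 hlt))) (not_lt.2 hx)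
  constructor
  · intro h
    by_contra hm
    refine absurd h (not_le.2 (Finset.card_lt_card
      (Finset.ssubset_iff_of_subset ?_ |>.2 ⟨c, by simp [hc], by simp [hm]⟩)))
    refine Finset.monotone_filter_right _ (fun x _ hx => ?_)
    exact (stripKey_lt.2 (Or.inl (by omega))).le
  · intro h
    exact Finset.card_le_card
      (Finset.monotone_filter_right _ (fun x _ hx => (hmono x hx).trans_lt h))

lemma exists_consecutive_in_strip {m v : ℕ} (h1 : stripEnd A a m < v)
    (h2 : v < stripEnd A a (m + 1)) :
    ∃ c ∈ A.cells, ∃ c' ∈ A.cells, (peelTableau A a).entry c = v ∧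
      (peelTableau A a).entry c' = v + 1 ∧ strip A a c = m ∧ strip A a c' = m ∧
      stripPos A a c < stripPos A a c' := by
  have hn : stripEnd A a (m + 1) ≤ A.size := Finset.card_filter_le _ _
  obtain ⟨c, hc, hcv⟩ := (peelTableau A a).exists_entry_eq (v := v) (by omega) (by omega)
  obtain ⟨c', hc', hcv'⟩ := (peelTableau A a).exists_entry_eq (v := v + 1) (by omega) (by omega)
  have e1 := peelTableau_entry_le_iff (a := a) hc m
  have e2 := peelTableau_entry_le_iff (a := a) hc (m + 1)
  have e3 := peelTableau_entry_le_iff (a := a) hc' m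
  have e4 := peelTableau_entry_le_iff (a := a) hc' (m + 1)
  refine ⟨c, hc, c', hc', hcv, hcv', by omega, by omega, ?_⟩
  by_contra hle
  have hk : stripKey A a c' ≤ stripKey A a c := by
    rw [← not_lt, stripKey_lt]
    omega
  have : (peelTableau A a).entry c' ≤ (peelTableau A a).entry c := by
    rw [peelTableau, SYT.entry_ofKey hc, SYT.entry_ofKey hc']
    exact Finset.card_le_card
      (Finset.monotone_filter_right _ (fun x _ hx => le_trans hx hk))
  omega

lemma mem_descentSet_peelTableau {m v : ℕ} (hm : m < a) (h1 : stripEnd A a m < v)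
    (h2 : v < stripEnd A a (m + 1)) : v ∈ (peelTableau A a).descentSet := by
  obtain ⟨c, hc, c', hc', hv, hv', hs, hs', hp⟩ := exists_consecutive_in_strip h1 h2
  rw [← hv, SYT.mem_descentSet_iff _ hc hc' (by omega)]
  exact fst_lt_of_strip_eq (by omega) (by omega) hp

lemma notMem_descentSet_peelTableau {m v : ℕ} (hm : a ≤ m) (h1 : stripEnd A a m < v)
    (h2 : v < stripEnd A a (m + 1)) : v ∉ (peelTableau A a).descentSet := by
  obtain ⟨c, hc, c', hc', hv, hv', hs, hs', hp⟩ := exists_consecutive_in_strip h1 h2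
  rw [← hv, SYT.mem_descentSet_iff _ hc hc' (by omega), not_lt]
  exact fst_le_of_strip_eq (by omega) hc hc' (by omega) hp

/-- The boxes outside the first `a` vertical and `b` horizontal strips of the peeling are
the bottom right corners of the `(b+1) × (a+1)` rectangles. -/
lemma size_le_stripEnd_add_rects (b : ℕ) :
    A.size ≤ stripEnd A a (a + b) + rects A.cells (b + 1) (a + 1) := by
  rw [SkewShape.size, ← Finset.card_filter_add_card_filter_not (fun c => strip A a c < a + b)]
  refine Nat.add_le_add_left ?_ _
  have key : ∀ c ∈ A.cells, a + b ≤ strip A a c →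
      b ≤ c.1 ∧ a ≤ c.2 ∧ (c.1 - b, c.2 - a) ∈ A.cells := by
    rintro ⟨i, j⟩ hc hs
    rw [SkewShape.mem_cells] at hc
    simp only [strip] at hs
    split_ifs at hs with h
    · omega
    · have h1 := colLen_le_of_rowLen_le (μ := A.mu) (i := i) (j := j - a) (by omega)
      have h2 : ¬ j - a < A.mu.rowLen (i - b) := by
        rw [← YoungDiagram.mem_iff_lt_rowLen, YoungDiagram.mem_iff_lt_colLen]
        omega
      by_cases hb : b ≤ i
      · have h3 := A.lam.rowLen_anti (i - b) i (by omega)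
        refine ⟨hb, by simp only; omega, SkewShape.mem_cells.2 ?_⟩
        simp only
        omega
      · omega
  refine Finset.card_le_card_of_injOn (fun c => (c.1 - b, c.2 - a)) ?_ ?_
  · rintro ⟨i, j⟩ hc
    have hc := Finset.mem_filter.1 (Finset.mem_coe.1 hc)
    obtain ⟨hi, hj, hm⟩ := key _ hc.1 (not_lt.1 hc.2)
    refine Finset.mem_coe.2 (Finset.mem_filter.2 ⟨hm, fun s hs t ht => ?_⟩)
    simp only at *
    exact SkewShape.mem_cells_of_between hm hc.1 (by omega) (by omega) (by omega) (by omega)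
  · rintro ⟨i, j⟩ hc ⟨i', j'⟩ hc' h
    have hc := Finset.mem_filter.1 (Finset.mem_coe.1 hc)
    have hc' := Finset.mem_filter.1 (Finset.mem_coe.1 hc')
    obtain ⟨hi, hj, -⟩ := key _ hc.1 (not_lt.1 hc.2)
    obtain ⟨hi', hj', -⟩ := key _ hc'.1 (not_lt.1 hc'.2)
    simp only [Prod.mk.injEq] at *
    omega

end Peeling

/-- If the entries of a tableau split off `a` consecutive runs of descents followed by `b`
consecutive runs of ascents, then each `(b+1) × (a+1)` rectangle has its bottom right corner
among the remaining entries. -/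
lemma SYT.lt_entry_corner {A : SkewShape} (T : SYT A) {a b : ℕ} (e : ℕ → ℕ) (he : e 0 = 0)
    (hdes : ∀ m < a, ∀ v, e m < v → v < e (m + 1) → v ∈ T.descentSet)
    (hasc : ∀ m, a ≤ m → ∀ v, e m < v → v < e (m + 1) → v ∉ T.descentSet)
    {i j : ℕ} (h : ∀ s ≤ b, ∀ t ≤ a, (i + s, j + t) ∈ A.cells) :
    e (a + b) < T.entry (i + b, j + a) := by
  have hrow : ∀ m ≤ a, e m < T.entry (i, j + m) := by
    intro m
    induction m with
    | zero =>
      intro _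
      have := Finset.mem_Icc.1 (T.mem_range _ (h 0 (by omega) 0 (by omega)))
      rw [he]
      exact this.1
    | succ m ih =>
      intro hm
      by_contra hle
      have hx := h 0 (by omega) m (by omega)
      have hy := h 0 (by omega) (m + 1) (by omega)
      have := T.lt_of_step Prod.fst (s := e m) (e := e (m + 1))
        (fun x hx y hy h1 h2 h3 => (T.mem_descentSet_iff hx hy h3).1 (hdes m (by omega) _ h1 h2))
        hx hy (ih (by omega)) (T.row_lt _ _ _ hx hy (by omega)) (by simpa using hle)
      simp at this
  have hcol : ∀ m ≤ b, e (a + m) < T.entry (i + m, j + a) := by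
    intro m
    induction m with
    | zero => exact fun _ => hrow a le_rfl
    | succ m ih =>
      intro hm
      by_contra hle
      have hx := h m (by omega) a (by omega)
      have hy := h (m + 1) (by omega) a (by omega)
      have := T.lt_of_step Prod.snd (s := e (a + m)) (e := e (a + m + 1))
        (fun x hx y hy h1 h2 h3 =>
          T.snd_lt_of_notMem_descentSet hx hy h3 (hasc (a + m) (by omega) _ h1 h2))
        hx hy (ih (by omega)) (T.col_lt _ _ _ hx hy (by omega)) (by simpa [add_assoc] using hle)
      simp at this
  exact hcol b le_rfl

lemma SYT.card_lt_entry_le {A : SkewShape} (T : SYT A) (v : ℕ) :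
    (A.cells.filter (fun c => v < T.entry c)).card ≤ A.size - v := by
  have : (A.cells.filter (fun c => v < T.entry c)).card ≤ (Finset.Ioc v A.size).card := by
    refine Finset.card_le_card_of_injOn T.entry ?_
      (T.injOn.mono (Finset.coe_subset.2 (Finset.filter_subset _ _)))
    intro c hc
    have hc := Finset.mem_filter.1 (Finset.mem_coe.1 hc)
    have := Finset.mem_Icc.1 (T.mem_range c hc.1)
    simp [hc.2, this.2]
  simpa using this

lemma rects_le_of_descentSet_eq {A B : SkewShape} {a b : ℕ} (T : SYT A) (hn : A.size = B.size)
    (hd : T.descentSet = (peelTableau B a).descentSet) :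
    rects A.cells (b + 1) (a + 1) ≤ rects B.cells (b + 1) (a + 1) := by
  have h1 : rects A.cells (b + 1) (a + 1) ≤
      (A.cells.filter (fun c => stripEnd B a (a + b) < T.entry c)).card := by
    refine Finset.card_le_card_of_injOn (fun c => (c.1 + b, c.2 + a)) ?_ ?_
    · rintro ⟨i, j⟩ hc
      have hc := (Finset.mem_filter.1 (Finset.mem_coe.1 hc)).2
      refine Finset.mem_coe.2 (Finset.mem_filter.2 ⟨hc b (by omega) a (by omega), ?_⟩)
      refine T.lt_entry_corner _ (by simp [stripEnd]) ?_ ?_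
        (fun s hs t ht => hc s (by omega) t (by omega))
      · rw [hd]
        exact fun m hm v => mem_descentSet_peelTableau hm
      · rw [hd]
        exact fun m hm v => notMem_descentSet_peelTableau hm
    · rintro ⟨i, j⟩ - ⟨i', j'⟩ - h
      simpa using h
  have h2 := T.card_lt_entry_le (stripEnd B a (a + b))
  have h3 := size_le_stripEnd_add_rects (A := B) (a := a) b
  omega

lemma eq_of_zipWith_sub_eq {l l' : List ℕ} {x : ℕ} (hl : (x :: l).IsChain (· ≤ ·))
    (hl' : (x :: l').IsChain (· ≤ ·))
    (h : List.zipWith (fun x y => x - y) l (x :: l) =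
      List.zipWith (fun x y => x - y) l' (x :: l')) : l = l' := by
  induction l generalizing x l' with
  | nil => cases l' <;> simp_all
  | cons y l ih =>
    cases l' with
    | nil => simp at h
    | cons y' l' =>
      rw [List.isChain_cons_cons] at hl hl'
      simp only [List.zipWith_cons_cons, List.cons.injEq] at h
      obtain rfl : y = y' := by omega
      rw [ih hl.2 hl'.2 h.2]

lemma compOfSet_inj {n n' : ℕ} {D D' : Finset ℕ} (hD : ∀ d ∈ D, d ∈ Finset.Ico 1 n)
    (hD' : ∀ d ∈ D', d ∈ Finset.Ico 1 n') (h : compOfSet n D = compOfSet n' D') :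
    n = n' ∧ D = D' := by
  have hchain : ∀ (m : ℕ) (E : Finset ℕ), (∀ d ∈ E, d ∈ Finset.Ico 1 m) →
      (0 :: (E.sort (· ≤ ·) ++ [m])).IsChain (· ≤ ·) := by
    intro m E hE
    refine List.Pairwise.isChain ?_
    rw [List.pairwise_cons, List.pairwise_append]
    refine ⟨by simp, E.pairwise_sort (· ≤ ·), by simp, ?_⟩
    intro d hd m' hm'
    have := Finset.mem_Ico.1 (hE d ((Finset.mem_sort _).1 hd))
    simp only [List.mem_singleton] at hm'
    omega
  have hlen : ∀ (m : ℕ) (E : Finset ℕ), compOfSet m E = [] → m = 0 := by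
    intro m E hE
    by_contra hm
    have := congrArg List.length hE
    simp [compOfSet, hm] at this
  have hempty : ∀ E : Finset ℕ, (∀ d ∈ E, d ∈ Finset.Ico 1 0) → E = ∅ := fun E hE =>
    Finset.eq_empty_of_forall_notMem fun d hd => by simpa using hE d hd
  by_cases hn : n = 0
  · subst hn
    have hn' : n' = 0 := hlen n' D' (by rw [← h]; simp [compOfSet])
    subst hn'
    exact ⟨rfl, by rw [hempty D hD, hempty D' hD']⟩
  by_cases hn' : n' = 0
  · subst hn'
    exact absurd (hlen n D (by rw [h]; simp [compOfSet])) hn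
  simp only [compOfSet, hn, hn', if_false] at h
  have hl := eq_of_zipWith_sub_eq (hchain n D hD) (hchain n' D' hD') h
  obtain ⟨h1, h2⟩ := List.append_inj' hl rfl
  refine ⟨by simpa using h2, ?_⟩
  rw [← Finset.sort_toFinset D (· ≤ ·), h1, Finset.sort_toFinset]

lemma SYT.descentSet_subset {A : SkewShape} (T : SYT A) :
    ∀ d ∈ T.descentSet, d ∈ Finset.Ico 1 A.size :=
  fun _ hd => (Finset.mem_filter.1 hd).1

lemma exists_descentSet_eq {A B : SkewShape} (h : ∀ α : List ℕ, countSYT B α ≤ countSYT A α)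
    (S : SYT B) : ∃ T : SYT A, A.size = B.size ∧ T.descentSet = S.descentSet := by
  have hpos : 0 < countSYT B S.descentComp :=
    Nat.card_pos_iff.2 ⟨⟨⟨S, rfl⟩⟩, inferInstance⟩
  obtain ⟨⟨T, hT⟩⟩ := (Nat.card_pos_iff.1 (hpos.trans_le (h _))).1
  exact ⟨T, compOfSet_inj T.descentSet_subset S.descentSet_subset hT⟩

theorem rects_le {A B : SkewShape} (h : ∀ α : List ℕ, countSYT B α ≤ countSYT A α)
    {k l : ℕ} (hk : 1 ≤ k) (hl : 1 ≤ l) : rects A.cells k l ≤ rects B.cells k l := by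
  obtain ⟨b, rfl⟩ := Nat.exists_eq_add_of_le' hk
  obtain ⟨a, rfl⟩ := Nat.exists_eq_add_of_le' hl
  obtain ⟨T, hn, hd⟩ := exists_descentSet_eq h (peelTableau B a)
  exact rects_le_of_descentSet_eq T hn hd

section Dominance

lemma sum_take_le_sum_tsub_add (L : List ℕ) (j c : ℕ) :
    (L.take j).sum ≤ (L.map (· - c)).sum + j * c := by
  induction L generalizing j with
  | nil => simp
  | cons x L ih =>
    cases j with
    | zero => simp
    | succ j =>
      have := ih j
      simp only [List.take_succ_cons, List.sum_cons, List.map_cons, add_mul, one_mul]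
      omega

lemma exists_sum_tsub_add_le_sum_take {L : List ℕ} (hL : L.Pairwise (· ≥ ·)) (j : ℕ) :
    ∃ c, (L.length ≤ j ∨ c ≤ L.headD 0) ∧
      (L.map (· - c)).sum + j * c ≤ (L.take j).sum := by
  induction L generalizing j with
  | nil => exact ⟨0, by simp⟩
  | cons x L ih =>
    rw [List.pairwise_cons] at hL
    cases j with
    | zero =>
      refine ⟨x, by simp, ?_⟩
      have : ∀ y ∈ (x :: L).map (· - x), y = 0 := by
        intro y hy
        obtain ⟨z, hz, rfl⟩ := List.mem_map.1 hy
        rcases List.mem_cons.1 hz with rfl | hz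
        · simp
        · have := hL.1 z hz
          omega
      rw [List.sum_eq_zero this]
      simp
    | succ j =>
      by_cases hj : L.length ≤ j
      · exact ⟨0, by simp, by simp [List.take_of_length_le hj]⟩
      · obtain ⟨c, hc, hs⟩ := ih hL.2 j
        have hcx : c ≤ x := by
          cases L with
          | nil => simp at hj
          | cons y L =>
            have h1 := hc.resolve_left hj
            have h2 := hL.1 y (by simp)
            simp only [List.headD_cons] at h1
            omega
        refine ⟨c, Or.inr hcx, ?_⟩
        simp only [List.take_succ_cons, List.sum_cons, List.map_cons, add_mul, one_mul]
        omega

lemma coe_sortDesc (s : Multiset ℕ) : (sortDesc s : Multiset ℕ) = s := by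
  rw [sortDesc, Multiset.coe_reverse, Multiset.sort_eq]

/-- Comparison of all truncated sums `∑ (x - c)⁺` implies (weak) dominance. -/
lemma dom_of_sum_tsub_le {s t : Multiset ℕ}
    (h : ∀ c, (s.map (· - c)).sum ≤ (t.map (· - c)).sum) : Dom s t := by
  intro j
  have ht : (sortDesc t).Pairwise (· ≥ ·) :=
    List.pairwise_reverse.2 (t.pairwise_sort (· ≤ ·))
  obtain ⟨c, -, hc⟩ := exists_sum_tsub_add_le_sum_take ht j
  have hs := sum_take_le_sum_tsub_add (sortDesc s) j c
  have hle := h c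
  rw [← coe_sortDesc s, ← coe_sortDesc t] at hle
  simp only [Multiset.map_coe, Multiset.sum_coe] at hle
  omega

end Dominance

lemma mem_rowCols {s : Finset (ℕ × ℕ)} {i j : ℕ} : j ∈ rowCols s i ↔ (i, j) ∈ s := by
  simp [rowCols]

lemma SkewShape.forall_mem_column_iff {A : SkewShape} {k i j : ℕ} :
    (∀ t < k + 1, (i + t, j) ∈ A.cells) ↔ A.mu.rowLen i ≤ j ∧ j < A.lam.rowLen (i + k) := by
  constructor
  · intro h
    have h0 := SkewShape.mem_cells.1 (h 0 (by omega))
    have h1 := SkewShape.mem_cells.1 (h k (by omega))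
    exact ⟨h0.1, h1.2⟩
  · intro h t ht
    have h1 := A.mu.rowLen_anti i (i + t) (by omega)
    have h2 := A.lam.rowLen_anti (i + t) (i + k) (by omega)
    exact SkewShape.mem_cells.2 (by omega)

lemma SkewShape.overlapRow_eq {A : SkewShape} (k i : ℕ) :
    overlapRow A.cells (k + 1) i = A.lam.rowLen (i + k) - A.mu.rowLen i := by
  rw [← Nat.card_Ico, overlapRow]
  congr 1
  ext j
  simp only [Finset.mem_filter, mem_rowCols, Finset.mem_Ico]
  rw [SkewShape.forall_mem_column_iff, and_iff_right_iff_imp]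
  exact fun h => SkewShape.forall_mem_column_iff.2 h 0 (by omega)

lemma SkewShape.rects_eq_sum {A : SkewShape} (k c : ℕ) :
    rects A.cells (k + 1) (c + 1) = ((rowsk A.cells (k + 1)).map (· - c)).sum := by
  have hfilter : ∀ s : Multiset ℕ,
      ((s.filter (fun m => 0 < m)).map (· - c)).sum = (s.map (· - c)).sum := by
    intro s
    induction s using Multiset.induction with
    | empty => simp
    | cons x s ih =>
      rcases Nat.eq_zero_or_pos x with rfl | hx
      · simp [ih]
      · simp [hx, ih]
  rw [rowsk, hfilter, Multiset.map_map, rects]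
  change _ = ∑ i ∈ A.cells.image Prod.fst, (overlapRow A.cells (k + 1) i - c)
  rw [Finset.card_eq_sum_card_fiberwise (f := Prod.fst) (t := A.cells.image Prod.fst)
    (fun x hx => Finset.mem_image_of_mem _ (Finset.mem_filter.1 (Finset.mem_coe.1 hx)).1)]
  refine Finset.sum_congr rfl fun i _ => ?_
  rw [SkewShape.overlapRow_eq, Nat.sub_right_comm, ← Nat.card_Ico]
  refine Finset.card_nbij' Prod.snd (fun j => (i, j)) ?_ ?_ ?_ ?_
  · rintro ⟨i', j⟩ h
    simp only [Finset.coe_filter, Finset.mem_filter, Set.mem_ofPred_eq] at h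
    obtain ⟨⟨-, h⟩, rfl⟩ := h
    have h1 := SkewShape.forall_mem_column_iff.1 (fun t ht => h t ht 0 (by omega))
    have h2 := SkewShape.forall_mem_column_iff.1 (fun t ht => h t ht c (by omega))
    simp only [Finset.coe_Ico, Set.mem_Ico]
    omega
  · intro j h
    simp only [Finset.coe_Ico, Set.mem_Ico] at h
    have hall : ∀ t < k + 1, ∀ u < c + 1, (i + t, j + u) ∈ A.cells := fun t ht u hu =>
      SkewShape.forall_mem_column_iff.2 (by omega) t ht
    simp only [Finset.coe_filter, Finset.mem_filter, Set.mem_ofPred_eq, and_true]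
    exact ⟨hall 0 (by omega) 0 (by omega), hall⟩
  · rintro ⟨i', j⟩ h
    simp only [Finset.coe_filter, Finset.mem_filter, Set.mem_ofPred_eq] at h
    rw [← h.2]
  · intro j _
    rfl

/-- The transposed skew shape. -/
def SkewShape.transpose (A : SkewShape) : SkewShape where
  lam := A.lam.transpose
  mu := A.mu.transpose
  sub := YoungDiagram.transpose_mono A.sub

lemma SkewShape.mem_cells_transpose {A : SkewShape} {c : ℕ × ℕ} :
    c ∈ A.transpose.cells ↔ c.swap ∈ A.cells := by
  simp [SkewShape.cells, SkewShape.transpose]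

lemma SkewShape.colsk_eq (A : SkewShape) (l : ℕ) : colsk A.cells l = rowsk A.transpose.cells l := by
  have h1 : A.cells.image Prod.snd = A.transpose.cells.image Prod.fst := by
    ext j
    simp [SkewShape.mem_cells_transpose]
  have h2 : colRows A.cells = rowCols A.transpose.cells := by
    ext j i
    simp [colRows, rowCols, SkewShape.mem_cells_transpose]
  have h3 : overlapCol A.cells l = overlapRow A.transpose.cells l := by
    funext j
    simp only [overlapCol, overlapRow, h2]
  rw [colsk, rowsk, h1, h3]

lemma SkewShape.rects_transpose (A : SkewShape) (k l : ℕ) :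
    rects A.transpose.cells l k = rects A.cells k l := by
  refine Finset.card_nbij' Prod.swap Prod.swap ?_ ?_ (fun _ _ => rfl) (fun _ _ => rfl)
  · intro c
    simp only [Finset.coe_filter, Set.mem_ofPred_eq, SkewShape.mem_cells_transpose,
      Prod.swap_prod_mk]
    exact fun h => ⟨h.1, fun s hs t ht => h.2 t ht s hs⟩
  · intro c
    simp only [Finset.coe_filter, Set.mem_ofPred_eq, SkewShape.mem_cells_transpose,
      Prod.swap_prod_mk]
    exact fun h => ⟨h.1, fun s hs t ht => h.2 t ht s hs⟩

/-- Rectangle inequalities imply dominance of the row overlap partitions. -/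
lemma dom_rowsk_of_rects_le {A B : SkewShape} {k : ℕ} (hk : 1 ≤ k)
    (h : ∀ l, 1 ≤ l → rects A.cells k l ≤ rects B.cells k l) :
    Dom (rowsk A.cells k) (rowsk B.cells k) := by
  obtain ⟨k, rfl⟩ := Nat.exists_eq_add_of_le' hk
  refine dom_of_sum_tsub_le fun c => ?_
  rw [← SkewShape.rects_eq_sum, ← SkewShape.rects_eq_sum]
  exact h (c + 1) (by omega)

theorem stmt1 (A B : SkewShape)
    (h : ∀ α : List ℕ, countSYT B α ≤ countSYT A α) :
    (∀ k, 1 ≤ k → Dom (rowsk A.cells k) (rowsk B.cells k)) ∧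
    (∀ l, 1 ≤ l → Dom (colsk A.cells l) (colsk B.cells l)) ∧
    (∀ k l, 1 ≤ k → 1 ≤ l → rects A.cells k l ≤ rects B.cells k l) := by
  refine ⟨fun k hk => ?_, fun l hl => ?_, fun k l hk hl => rects_le h hk hl⟩
  · exact dom_rowsk_of_rects_le hk fun l hl => rects_le h hk hl
  · rw [SkewShape.colsk_eq, SkewShape.colsk_eq]
    refine dom_rowsk_of_rects_le hl fun k hk => ?_
    rw [SkewShape.rects_transpose, SkewShape.rects_transpose]
    exact rects_le h hk hl

end SkewPaper
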